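/- Let $(R,\mathfrak m)$ be a Noetherian local ring, $I$ an ideal of $R$, and $N$ a finitely generated $R$-module with $n = \dim(N)$. Then the support $\operatorname{Supp}(H^{n-1}_I(N))$ of the $(n-1)$-st local cohomology module of $N$ with respect to $I$ is a finite set. -/

import Mathlib

open Opposite CategoryTheory CategoryTheory.Limits TensorProduct
noncomputable section
universe u

section Bridge
variable {R : Type u} [CommRing R]

abbrev homF (Y : ModuleCat.{u} R) : ModuleCat.{u} R ⥤ (ModuleCat.{u} R)ᵒᵖ :=
  ((linearYoneda R (ModuleCat.{u} R)).obj Y).rightOp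

abbrev homK {X : ModuleCat.{u} R} (P : ProjectiveResolution X) (Y : ModuleCat.{u} R) :
    ChainComplex (ModuleCat.{u} R)ᵒᵖ ℕ :=
  ((homF Y).mapHomologicalComplex _).obj P.complex

def clsMap {X : ModuleCat.{u} R} (P : ProjectiveResolution X) (Y : ModuleCat.{u} R) (n : ℕ) :
    ((homK P Y).opcycles n).unop ⟶ ((_root_.Ext R (ModuleCat.{u} R) n).obj (op X)).obj Y :=
  ((homK P Y).homologyι n).unop ≫ (P.isoLeftDerivedObj (homF Y) n).hom.unop

def clsInc {X : ModuleCat.{u} R} (P : ProjectiveResolution X) (Y : ModuleCat.{u} R) (n : ℕ) :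
    ((homK P Y).opcycles n).unop ⟶ ModuleCat.of R (P.complex.X n ⟶ Y) :=
  ((homK P Y).pOpcycles n).unop

instance {X : ModuleCat.{u} R} (P : ProjectiveResolution X) (Y : ModuleCat.{u} R) (n : ℕ) :
    Epi (clsMap P Y n) := by
  have h1 : Epi ((homK P Y).homologyι n).unop := inferInstance
  have h2 : Epi (P.isoLeftDerivedObj (homF Y) n).hom.unop := inferInstance
  exact @epi_comp _ _ _ _ _ _ h1 _ h2

instance {X : ModuleCat.{u} R} (P : ProjectiveResolution X) (Y : ModuleCat.{u} R) (n : ℕ) :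
    Mono (clsInc P Y n) := by unfold clsInc; exact inferInstanceAs (Mono ((homK P Y).pOpcycles n).unop)

lemma clsInc_cocycle {X : ModuleCat.{u} R} (P : ProjectiveResolution X) (Y : ModuleCat.{u} R)
    (n : ℕ) (z : ((homK P Y).opcycles n).unop) :
    P.complex.d (n+1) n ≫ (clsInc P Y n z : P.complex.X n ⟶ Y) = 0 := by
  have h := congrArg Quiver.Hom.unop ((homK P Y).d_pOpcycles (n+1) n)
  have h2 := congrArg (fun f => f.hom z) h
  exact h2

lemma clsMap_coboundary {X : ModuleCat.{u} R} (P : ProjectiveResolution X) (Y : ModuleCat.{u} R)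
    (n p : ℕ) (_ : p + 1 = n) (z : ((homK P Y).opcycles n).unop) (h : P.complex.X p ⟶ Y)
    (hz : (clsInc P Y n z : P.complex.X n ⟶ Y) = P.complex.d n p ≫ h) :
    clsMap P Y n z = 0 := by
  let w : ((homK P Y).opcycles n).unop := ((homK P Y).fromOpcycles n p).unop.hom h
  have hw : clsInc P Y n w = P.complex.d n p ≫ h := by
    have h1 := congrArg Quiver.Hom.unop ((homK P Y).p_fromOpcycles n p)
    exact congrArg (fun f => f.hom h) h1
  have : z = w := (ModuleCat.mono_iff_injective (clsInc P Y n)).1 inferInstance (hz.trans hw.symm)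
  rw [this]
  have h1 := congrArg Quiver.Hom.unop ((homK P Y).homologyι_comp_fromOpcycles n p)
  have h2 : ((homK P Y).homologyι n).unop.hom w = 0 := congrArg (fun f => f.hom h) h1
  change (P.isoLeftDerivedObj (homF Y) n).hom.unop.hom (((homK P Y).homologyι n).unop.hom w) = 0
  rw [h2]
  exact map_zero _

lemma clsMap_natural {X X' : ModuleCat.{u} R} (P : ProjectiveResolution X)
    (P' : ProjectiveResolution X') (Y : ModuleCat.{u} R) (n : ℕ) (π : X' ⟶ X)
    (φ : P'.complex ⟶ P.complex) (comm : φ.f 0 ≫ P.π.f 0 = P'.π.f 0 ≫ π)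
    (z : ((homK P Y).opcycles n).unop) :
    ∃ z' : ((homK P' Y).opcycles n).unop,
      (clsInc P' Y n z' : P'.complex.X n ⟶ Y) = φ.f n ≫ (clsInc P Y n z : P.complex.X n ⟶ Y) ∧
      clsMap P' Y n z' = ((_root_.Ext R (ModuleCat.{u} R) n).map π.op).app Y (clsMap P Y n z) := by
  let ψ : homK P' Y ⟶ homK P Y := ((homF Y).mapHomologicalComplex _).map φ
  refine ⟨(HomologicalComplex.opcyclesMap ψ n).unop.hom z, ?_, ?_⟩
  · have h1 := congrArg Quiver.Hom.unop (HomologicalComplex.p_opcyclesMap ψ n)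
    exact congrArg (fun f => f.hom z) h1
  · have h1 := congrArg Quiver.Hom.unop (HomologicalComplex.homologyι_naturality ψ n)
    have h2 := congrArg Quiver.Hom.unop
      (ProjectiveResolution.isoLeftDerivedObj_hom_naturality π P' P φ comm (homF Y) n)
    have h3 := congrArg (fun f => f.hom z) h1
    have h4 := congrArg (fun f => f.hom (((homK P Y).homologyι n).unop.hom z)) h2
    refine Eq.trans ?_ h4.symm
    change (P'.isoLeftDerivedObj (homF Y) n).hom.unop.hom _ = (P'.isoLeftDerivedObj (homF Y) n).hom.unop.hom _
    exact congrArg _ h3.symm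

lemma old_rep {X Y : ModuleCat.{u} R} (n : ℕ) (P : ProjectiveResolution X)
    (x : ((_root_.Ext R (ModuleCat.{u} R) n).obj (op X)).obj Y) :
    ∃ f : P.complex.X n ⟶ Y, P.complex.d (n+1) n ≫ f = 0 ∧
      ∀ {X' : ModuleCat.{u} R} (P' : ProjectiveResolution X') (π : X' ⟶ X)
        (φ : P'.complex ⟶ P.complex) (_ : φ.f 0 ≫ P.π.f 0 = P'.π.f 0 ≫ π) (r : R),
        (r • (φ.f n ≫ f) = 0 ∨ ∃ (p : ℕ) (h : P'.complex.X p ⟶ Y), p + 1 = n ∧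
          P'.complex.d n p ≫ h = r • (φ.f n ≫ f)) →
        r • (((_root_.Ext R (ModuleCat.{u} R) n).map π.op).app Y x) = 0 := by
  obtain ⟨z, rfl⟩ := (ModuleCat.epi_iff_surjective (clsMap P Y n)).1 inferInstance x
  refine ⟨clsInc P Y n z, clsInc_cocycle P Y n z, ?_⟩
  intro X' P' π φ comm r H
  obtain ⟨z', h1, h2⟩ := clsMap_natural P P' Y n π φ comm z
  rw [← h2, ← map_smul]
  have h3 : (clsInc P' Y n (r • z') : P'.complex.X n ⟶ Y) = r • (φ.f n ≫ (clsInc P Y n z : P.complex.X n ⟶ Y)) := by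
    rw [← h1]; exact map_smul _ _ _
  rcases H with H | ⟨p, h, hp, H⟩
  · rw [H] at h3
    have : r • z' = 0 := (ModuleCat.mono_iff_injective (clsInc P' Y n)).1 inferInstance
      (h3.trans (map_zero (clsInc P' Y n).hom).symm)
    rw [this, map_zero]
  · exact clsMap_coboundary P' Y n p hp _ h (h3.trans H.symm)


lemma new_to_old {X Y : ModuleCat.{u} R} (n : ℕ)
    (x : ((_root_.Ext R (ModuleCat.{u} R) n).obj (op X)).obj Y) :
    ∃ e : Abelian.Ext X Y n, ∀ {X' : ModuleCat.{u} R} (π : X' ⟶ X) (r : R), n ≠ 0 →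
      r • ((Abelian.Ext.mk₀ π).comp e (zero_add n)) = 0 →
        r • (((_root_.Ext R (ModuleCat.{u} R) n).map π.op).app Y x) = 0 := by
  let P := ProjectiveResolution.of X
  obtain ⟨f, hf, H⟩ := old_rep n P x
  refine ⟨P.extMk f (n+1) rfl hf, ?_⟩
  intro X' π r hn h
  let P' := ProjectiveResolution.of X'
  obtain ⟨p, rfl⟩ := Nat.exists_eq_succ_of_ne_zero hn
  let φ : ProjectiveResolution.Hom P' P π := 
    { hom := ProjectiveResolution.lift π P' P
      hom_f_zero_comp_π_f_zero := ProjectiveResolution.lift_commutes_zero π P' P }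
  refine H P' π φ.hom (ProjectiveResolution.lift_commutes_zero π P' P) r (Or.inr ⟨p, ?_⟩)
  rw [ProjectiveResolution.mk₀_comp_extMk (hf := hf) (φ := φ), Abelian.Ext.smul_eq_comp_mk₀,
    ProjectiveResolution.extMk_comp_mk₀, ProjectiveResolution.extMk_eq_zero_iff (hp := rfl)] at h
  obtain ⟨g, hg⟩ := h
  refine ⟨g, rfl, hg.trans ?_⟩
  simp

lemma old_smul_zero {X Y : ModuleCat.{u} R} (n : ℕ) (r : R) (hr : ∀ y : Y, r • y = 0)
    (x : ((_root_.Ext R (ModuleCat.{u} R) n).obj (op X)).obj Y) : r • x = 0 := by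
  obtain ⟨f, hf, H⟩ := old_rep n (ProjectiveResolution.of X) x
  have := H (ProjectiveResolution.of X) (𝟙 X) (𝟙 _)
    ((Category.id_comp _).trans (Category.comp_id _).symm) r (Or.inl (by
    ext y; exact hr _))
  have h2 : ((_root_.Ext R (ModuleCat.{u} R) n).map (𝟙 X).op).app Y = 𝟙 _ := by
    rw [op_id, CategoryTheory.Functor.map_id]; rfl
  rw [h2] at this
  exact this

def quotMap (I : Ideal R) {s t : ℕ} (h : t ≤ s) : ModuleCat.of R (R ⧸ I ^ s) ⟶ ModuleCat.of R (R ⧸ I ^ t) :=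
  ModuleCat.ofHom (Submodule.mapQ _ _ LinearMap.id (Ideal.pow_le_pow_right h))

/-- `q` is not in the support of the colimit, elementwise. -/
def Van (I : Ideal R) (d : ℕ) (N : ModuleCat.{u} R) (q : PrimeSpectrum R) : Prop :=
  ∀ (t : ℕ) (e : Abelian.Ext (ModuleCat.of R (R ⧸ I ^ t)) N d),
    ∃ r ∉ q.asIdeal, ∃ (s : ℕ) (h : t ≤ s),
      r • ((Abelian.Ext.mk₀ (quotMap I h)).comp e (zero_add d)) = 0

lemma lc_rep (I : Ideal R) (d : ℕ) (N : ModuleCat.{u} R) (x : (localCohomology I d).obj N) :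
    ∃ (t : ℕ) (e : ((_root_.Ext R (ModuleCat.{u} R) d).obj (op (ModuleCat.of R (R ⧸ I ^ t)))).obj N),
      ∀ (s : ℕ) (h : t ≤ s) (r : R),
        r • (((_root_.Ext R (ModuleCat.{u} R) d).map (quotMap I h).op).app N e) = 0 → r • x = 0 := by
  let D := localCohomology.diagram (localCohomology.idealPowersDiagram I) d
  have : HasColimit D := localCohomology.hasColimitDiagram _ _
  let c : Cocone (D ⋙ (evaluation _ _).obj N) := ((evaluation _ _).obj N).mapCocone (colimit.cocone D)
  have hc : IsColimit c := isColimitOfPreserves _ (colimit.isColimit D)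
  have : PreservesFilteredColimitsOfSize.{0, 0} (forget (ModuleCat.{u} R)) :=
    preservesFilteredColimitsOfSize_shrink.{0, u, 0, u} _
  have hc' := isColimitOfPreserves (forget (ModuleCat.{u} R)) hc
  obtain ⟨j, e, he⟩ := Types.jointly_surjective_of_isColimit hc' x
  obtain ⟨j⟩ := j
  obtain ⟨t⟩ := j
  refine ⟨t, e, ?_⟩
  intro s h r hr
  let w : (op (op t) : ℕᵒᵖᵒᵖ) ⟶ op (op s) := (homOfLE h).op.op
  have hw := c.w w
  have h1 : c.ι.app (op (op t)) e = x := he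
  have h2 : c.ι.app (op (op s)) ((D ⋙ (evaluation _ _).obj N).map w e) = c.ι.app (op (op t)) e := by
    rw [← hw]; rfl
  have h3 : r • (D ⋙ (evaluation _ _).obj N).map w e = 0 := hr
  have h4 : r • c.ι.app (op (op s)) ((D ⋙ (evaluation _ _).obj N).map w e) = 0 := by
    rw [← map_smul, h3, map_zero]
  rw [h2] at h4
  rw [← h1]
  exact h4

lemma notMem_support_of_van (I : Ideal R) (d : ℕ) (hd : d ≠ 0) (N : ModuleCat.{u} R)
    (q : PrimeSpectrum R) (h : Van I d N q) :
    q ∉ Module.support R ((localCohomology I d).obj N) := by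
  rw [Module.notMem_support_iff']
  intro x
  obtain ⟨t, e, H⟩ := lc_rep I d N x
  obtain ⟨e', H'⟩ := new_to_old d e
  obtain ⟨r, hr, s, hs, h0⟩ := h t e'
  exact ⟨r, hr, H s hs r (H' _ r hd h0)⟩

lemma lc_support_subset (I : Ideal R) (d : ℕ) (N : ModuleCat.{u} R) [Module.Finite R N] :
    Module.support R ((localCohomology I d).obj N) ⊆ Module.support R N := by
  intro q hq
  rw [Module.mem_support_iff_of_finite]
  intro r hr
  by_contra hrq
  rw [Module.mem_annihilator] at hr
  refine Module.notMem_support_iff'.2 ?_ hq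
  intro x
  obtain ⟨t, e, H⟩ := lc_rep I d N x
  exact ⟨r, hrq, H t le_rfl r (old_smul_zero d r hr _)⟩

end Bridge

section Facts
variable {R : Type u} [CommRing R]
open Abelian (Ext)
open CategoryTheory.Abelian.Ext

lemma quotMap_comp (I : Ideal R) {s t v : ℕ} (h : t ≤ s) (h' : s ≤ v) :
    quotMap I h' ≫ quotMap I h = quotMap I (h.trans h') := by
  ext x; rfl

/-- restriction of classes -/
def pull (I : Ideal R) {s t d : ℕ} (h : t ≤ s) {N : ModuleCat.{u} R}
    (e : Abelian.Ext (ModuleCat.of R (R ⧸ I ^ t)) N d) :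
    Abelian.Ext (ModuleCat.of R (R ⧸ I ^ s)) N d :=
  (mk₀ (quotMap I h)).comp e (zero_add d)

lemma pull_pull (I : Ideal R) {s t v d : ℕ} (h : t ≤ s) (h' : s ≤ v) {N : ModuleCat.{u} R}
    (e : Abelian.Ext (ModuleCat.of R (R ⧸ I ^ t)) N d) :
    pull I h' (pull I h e) = pull I (h.trans h') e := by
  unfold pull
  rw [mk₀_comp_mk₀_assoc, quotMap_comp]

lemma pull_smul (I : Ideal R) {s t d : ℕ} (h : t ≤ s) {N : ModuleCat.{u} R} (r : R)
    (e : Abelian.Ext (ModuleCat.of R (R ⧸ I ^ t)) N d) :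
    pull I h (r • e) = r • pull I h e := by
  unfold pull
  rw [comp_smul]

lemma pull_comp (I : Ideal R) {s t d k l : ℕ} (h : t ≤ s) {N N' : ModuleCat.{u} R}
    (e : Abelian.Ext (ModuleCat.of R (R ⧸ I ^ t)) N d) (f : Abelian.Ext N N' k) (hl : d + k = l) :
    pull I h (e.comp f hl) = (pull I h e).comp f hl := by
  unfold pull
  rw [comp_assoc]
  lia

lemma van_exact (I : Ideal R) (d : ℕ) (q : PrimeSpectrum R) (S : ShortComplex (ModuleCat.{u} R))
    (hS : S.ShortExact) (h1 : Van I d S.X₁ q) (h3 : Van I d S.X₃ q) : Van I d S.X₂ q := by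
  intro t e
  obtain ⟨r, hr, s, hs, h0⟩ := h3 t (e.comp (mk₀ S.g) (add_zero d))
  change r • pull I hs _ = 0 at h0
  rw [pull_comp, ← smul_comp] at h0
  obtain ⟨e', he'⟩ := covariant_sequence_exact₂ _ hS _ h0
  obtain ⟨r', hr', s', hs', h0'⟩ := h1 s e'
  refine ⟨r' * r, fun h => (q.2.mem_or_mem h).elim hr' hr, s', hs.trans hs', ?_⟩
  change r' • pull I hs' e' = 0 at h0'
  change (r' * r) • pull I _ e = 0
  rw [mul_smul, ← pull_pull I hs hs', ← pull_smul, ← he', pull_comp, ← smul_comp, h0', Abelian.Ext.zero_comp]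

lemma van_succ (I : Ideal R) (d : ℕ) (q : PrimeSpectrum R) (a : R) (ha : a ∈ I)
    {N Q : ModuleCat.{u} R} (g : N ⟶ Q) (w : (a • 𝟙 N) ≫ g = 0)
    (hS : (ShortComplex.mk (a • 𝟙 N) g w).ShortExact) (h : Van I d Q q) : Van I (d + 1) N q := by
  have key : ∀ (k t : ℕ) (e : Abelian.Ext (ModuleCat.of R (R ⧸ I ^ t)) N (d + 1)), a ^ k • e = 0 →
      ∃ r ∉ q.asIdeal, ∃ (s : ℕ) (h : t ≤ s), r • pull I h e = 0 := by
    intro k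
    induction k with
    | zero =>
      intro t e he
      rw [pow_zero, one_smul] at he
      refine ⟨1, fun h => q.2.ne_top ((Ideal.eq_top_iff_one _).2 h), t, le_rfl, ?_⟩
      rw [he, pull, Abelian.Ext.comp_zero, smul_zero]
    | succ k ih =>
      intro t e he
      have h1 : (a ^ k • e).comp (mk₀ (a • 𝟙 N)) (add_zero _) = 0 := by
        rw [mk₀_smul, comp_smul, comp_mk₀_id, ← mul_smul, ← pow_succ', he]
      obtain ⟨f, hf⟩ := covariant_sequence_exact₁ _ hS (a ^ k • e) h1 rfl
      obtain ⟨r, hr, s, hs, h0⟩ := h t f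
      change r • pull I hs f = 0 at h0
      have h2 : a ^ k • (r • pull I hs e) = 0 := by
        rw [smul_comm, ← pull_smul, ← hf, pull_comp, ← smul_comp, h0, Abelian.Ext.zero_comp]
      obtain ⟨r', hr', s', hs', h0'⟩ := ih s _ h2
      refine ⟨r' * r, fun h => (q.2.mem_or_mem h).elim hr' hr, s', hs.trans hs', ?_⟩
      rw [mul_smul, ← pull_pull I hs hs', ← pull_smul, h0']
  intro t e
  refine key t t e ?_
  have h1 : a ^ t • 𝟙 (ModuleCat.of R (R ⧸ I ^ t)) = 0 := by
    ext x
    change a ^ t • (Ideal.Quotient.mk (I ^ t) 1) = 0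
    rw [← Ideal.Quotient.mk_eq_mk, ← Submodule.Quotient.mk_smul, Submodule.Quotient.mk_eq_zero]
    simpa using Ideal.pow_mem_pow ha t
  rw [← mk₀_id_comp e, ← smul_comp, ← mk₀_smul, h1, mk₀_zero, Abelian.Ext.zero_comp]

lemma van_zero (I : Ideal R) (d : ℕ) (q : PrimeSpectrum R) (N : ModuleCat.{u} R) [Module.Finite R N]
    (hq : q ∉ Module.support R N) : Van I d N q := by
  rw [Module.mem_support_iff_of_finite] at hq
  obtain ⟨r, hr, hrq⟩ := Set.not_subset.1 hq
  rw [SetLike.mem_coe, Module.mem_annihilator] at hr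
  intro t e
  refine ⟨r, hrq, t, le_rfl, ?_⟩
  have h1 : r • 𝟙 N = 0 := by ext x; exact hr x
  rw [smul_eq_comp_mk₀, h1, mk₀_zero, Abelian.Ext.comp_zero]

lemma ker_key {A₁ A₂ B₁ B₂ : Type u} [AddCommGroup A₁] [AddCommGroup A₂] [AddCommGroup B₁]
    [AddCommGroup B₂] [Module R A₁] [Module R A₂] [Module R B₁] [Module R B₂]
    [Projective (ModuleCat.of R A₂)]
    (f₁ : A₁ →ₗ[R] B₁) (f₂ : A₂ →ₗ[R] B₂) (a : A₁ →ₗ[R] A₂) (b : B₁ →ₗ[R] B₂)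
    (hcomm : ∀ x, f₂ (a x) = b (f₁ x)) (h₁ : Function.Surjective f₁) (h₂ : Function.Surjective f₂)
    (L : Submodule R (LinearMap.ker f₂))
    (hL : ∀ (x : A₁) (_ : f₁ x = 0) (hx : a x ∈ LinearMap.ker f₂),
      (⟨a x, hx⟩ : LinearMap.ker f₂) ∈ L)
    (N : ModuleCat.{u} R) (i : ℕ)
    (hβ : ∀ e : Abelian.Ext (ModuleCat.of R (LinearMap.ker f₂)) N i,
      (mk₀ (ModuleCat.ofHom L.subtype)).comp e (zero_add i) = 0)
    (e : Abelian.Ext (ModuleCat.of R B₂) N (i + 1)) :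
    (mk₀ (ModuleCat.ofHom b)).comp e (zero_add (i + 1)) = 0 := by
  have hS₁ := LinearMap.shortExact_shortComplexKer h₁
  have hS₂ := LinearMap.shortExact_shortComplexKer h₂
  have hres : ∀ x ∈ LinearMap.ker f₁, a x ∈ LinearMap.ker f₂ := by
    intro x hx
    rw [LinearMap.mem_ker] at hx ⊢
    rw [hcomm, hx, map_zero]
  let α : LinearMap.ker f₁ →ₗ[R] L :=
    LinearMap.codRestrict L (a.restrict hres) (fun x => hL x.1 x.2 _)
  let φ : f₁.shortComplexKer ⟶ f₂.shortComplexKer :=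
    { τ₁ := ModuleCat.ofHom α ≫ ModuleCat.ofHom L.subtype
      τ₂ := ModuleCat.ofHom a
      τ₃ := ModuleCat.ofHom b
      comm₁₂ := by ext x; rfl
      comm₂₃ := by ext x; exact hcomm x }
  have : Projective f₂.shortComplexKer.X₂ := ‹Projective (ModuleCat.of R A₂)›
  obtain ⟨x, hx⟩ := contravariant_sequence_exact₃ hS₂ N e
    (eq_zero_of_projective _) (n₀ := i) (add_comm _ _)
  have nat := ShortComplex.ShortExact.extClass_naturality hS₁ hS₂ φ
  rw [← hx]
  change (mk₀ φ.τ₃).comp _ _ = 0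
  rw [← comp_assoc (a₁₂ := 1) _ _ _ (by lia) (by lia) (by lia), ← nat,
    comp_assoc (a₂₃ := i) _ _ _ (by lia) (by lia) (by lia)]
  have h3 : (mk₀ φ.τ₁).comp x (zero_add i) = 0 := by
    change (mk₀ (ModuleCat.ofHom α ≫ ModuleCat.ofHom L.subtype)).comp x _ = 0
    rw [← mk₀_comp_mk₀_assoc]
    have := hβ x
    rw [this, Abelian.Ext.comp_zero]
  rw [h3, Abelian.Ext.comp_zero]

lemma artin_rees_ext [IsNoetherianRing R] (I : Ideal R) (N : ModuleCat.{u} R)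
    (hN : ∀ a ∈ I, ∀ y : N, a • y = 0) (i : ℕ) :
    ∀ (M : Type u) [AddCommGroup M] [Module R M] [Module.Finite R M], ∃ s : ℕ,
      ∀ e : Abelian.Ext (ModuleCat.of R M) N i,
        (mk₀ (ModuleCat.ofHom (I ^ s • (⊤ : Submodule R M)).subtype)).comp e (zero_add i) = 0 := by
  induction i with
  | zero =>
    intro M _ _ _
    refine ⟨1, fun e => ?_⟩
    obtain ⟨f, rfl⟩ := (mk₀_bijective _ _).2 e
    rw [mk₀_comp_mk₀, ← mk₀_zero]
    congr 1
    ext ⟨x, hx⟩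
    change f.hom x = 0
    rw [pow_one] at hx
    refine Submodule.smul_induction_on hx ?_ ?_
    · intro a ha m _
      rw [map_smul]
      exact hN a ha _
    · intro x y hx hy
      rw [map_add, hx, hy, add_zero]
  | succ i ih =>
    intro M _ _ _
    obtain ⟨n, f, hf⟩ := Module.Finite.exists_fin' R M
    obtain ⟨s₀, hs₀⟩ := ih (LinearMap.ker f)
    obtain ⟨k, hk⟩ := Ideal.exists_pow_inf_eq_pow_smul I (LinearMap.ker f)
    refine ⟨s₀ + k, ?_⟩
    let A₁ : Submodule R (Fin n → R) := I ^ (s₀ + k) • ⊤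
    let B₁ : Submodule R M := I ^ (s₀ + k) • ⊤
    have hmap : A₁.map f = B₁ := by
      simp only [A₁, B₁]
      rw [Submodule.map_smul'', Submodule.map_top, LinearMap.range_eq_top.2 hf]
    have hres : ∀ x ∈ A₁, f x ∈ B₁ := fun x hx => hmap ▸ Submodule.mem_map_of_mem hx
    have : Projective (ModuleCat.of R (Fin n → R)) :=
      (IsProjective.iff_projective (R := R) (Fin n → R)).1 inferInstance
    refine ker_key (f.restrict hres) f A₁.subtype B₁.subtype (fun x => rfl) ?_ hf
      (I ^ s₀ • ⊤) ?_ N i hs₀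
    · rintro ⟨y, hy⟩
      rw [← hmap] at hy
      obtain ⟨x, hx, rfl⟩ := hy
      exact ⟨⟨x, hx⟩, rfl⟩
    · intro x _ hx
      have h1 : (x : Fin n → R) ∈ A₁ ⊓ LinearMap.ker f := ⟨x.2, hx⟩
      simp only [A₁] at h1
      rw [hk (s₀ + k) (by lia), Nat.add_sub_cancel] at h1
      have h2 := Submodule.smul_mono (le_refl (I ^ s₀))
        (inf_le_right : I ^ k • (⊤ : Submodule R (Fin n → R)) ⊓ LinearMap.ker f ≤ _) h1
      have h3 : (I ^ s₀ • (⊤ : Submodule R (LinearMap.ker f))).map (LinearMap.ker f).subtype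
          = I ^ s₀ • LinearMap.ker f := by
        rw [Submodule.map_smul'', Submodule.map_top, Submodule.range_subtype]
      rw [← h3] at h2
      obtain ⟨y, hy, hyx⟩ := h2
      have : y = ⟨A₁.subtype x, hx⟩ := Subtype.ext hyx
      exact this ▸ hy

lemma van_torsion [IsNoetherianRing R] (I : Ideal R) (N : ModuleCat.{u} R)
    (hN : ∀ a ∈ I, ∀ y : N, a • y = 0) (i : ℕ) (q : PrimeSpectrum R) : Van I (i + 1) N q := by
  intro t e
  obtain ⟨s, hs⟩ := artin_rees_ext I N hN i (LinearMap.ker (Submodule.mkQ (I ^ t)))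
  refine ⟨1, fun h => q.2.ne_top ((Ideal.eq_top_iff_one _).2 h), s + t, by lia, ?_⟩
  rw [one_smul]
  have : Projective (ModuleCat.of R R) :=
    (IsProjective.iff_projective (R := R) R).1 inferInstance
  refine ker_key (Submodule.mkQ (I ^ (s + t))) (Submodule.mkQ (I ^ t)) LinearMap.id _
    (fun x => rfl) (Submodule.mkQ_surjective _) (Submodule.mkQ_surjective _) (I ^ s • ⊤) ?_ N i hs e
  intro x hx hx'
  have h1 : x ∈ I ^ (s + t) := (Submodule.Quotient.mk_eq_zero _).1 hx
  have h3 : (I ^ s • (⊤ : Submodule R (LinearMap.ker (Submodule.mkQ (I ^ t))))).map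
      (LinearMap.ker (Submodule.mkQ (I ^ t))).subtype = I ^ (s + t) := by
    rw [Submodule.map_smul'', Submodule.map_top, Submodule.range_subtype, Submodule.ker_mkQ,
      pow_add, smul_eq_mul]
  rw [← h3] at h1
  obtain ⟨y, hy, hyx⟩ := h1
  have : y = ⟨x, hx'⟩ := Subtype.ext hyx
  exact this ▸ hy

end Facts

section Main
variable {R : Type u} [CommRing R] [IsNoetherianRing R]

lemma finite_support_of_dim_le_one [IsLocalRing R] (N : Type u) [AddCommGroup N] [Module R N]
    [Module.Finite R N] (h : Module.supportDim R N ≤ 1) : (Module.support R N).Finite := by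
  have hfin := Ideal.finite_minimalPrimes_of_isNoetherianRing R (Module.annihilator R N)
  have hfin' : (PrimeSpectrum.asIdeal ⁻¹' (Module.annihilator R N).minimalPrimes).Finite :=
    hfin.preimage (fun x _ y _ hxy => PrimeSpectrum.ext hxy)
  refine (hfin'.union (Set.finite_singleton (IsLocalRing.closedPoint R))).subset ?_
  intro q hq
  by_contra hcon
  rw [Set.mem_union, not_or] at hcon
  obtain ⟨h1, h2⟩ := hcon
  have hqs := hq
  rw [Module.mem_support_iff_of_finite] at hq
  obtain ⟨p, hp, hpq⟩ := Ideal.exists_minimalPrimes_le hq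
  have hpprime : p.IsPrime := hp.1.1
  let P : PrimeSpectrum R := ⟨p, hpprime⟩
  have hP : P ∈ Module.support R N := Module.mem_support_iff_of_finite.2 hp.1.2
  have hPq : P < q := by
    refine lt_of_le_of_ne hpq ?_
    intro h
    exact h1 (by rw [Set.mem_preimage, ← h]; exact hp)
  have hqm : q < IsLocalRing.closedPoint R :=
    lt_of_le_of_ne (IsLocalRing.le_maximalIdeal q.2.ne_top) h2
  have hm : IsLocalRing.closedPoint R ∈ Module.support R N :=
    Module.mem_support_mono hqm.le hqs
  let S : LTSeries (Module.support R N) :=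
    { length := 2
      toFun := ![⟨P, hP⟩, ⟨q, hqs⟩, ⟨IsLocalRing.closedPoint R, hm⟩]
      step := by
        intro i
        fin_cases i
        · exact hPq
        · exact hqm }
  have := (Order.LTSeries.length_le_krullDim S).trans h
  have h3 : ((2 : ℕ) : WithBot ℕ∞) ≤ ((1 : ℕ) : WithBot ℕ∞) := this
  norm_cast at h3

lemma main_claim [IsLocalRing R] (I : Ideal R) (d : ℕ) :
    ∀ (N : Type u) [AddCommGroup N] [Module R N] [Module.Finite R N],
      Module.supportDim R N ≤ ((d + 1 : ℕ) : WithBot ℕ∞) →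
        {q | ¬ Van I d (ModuleCat.of R N) q}.Finite := by
  induction d with
  | zero =>
    intro N _ _ _ h
    refine (finite_support_of_dim_le_one N (by simpa using h)).subset ?_
    intro q hq
    by_contra h'
    exact hq (van_zero I 0 q (ModuleCat.of R N) h')
  | succ d ih =>
    intro N _ _ hNf
    induction hNf using IsNoetherianRing.induction_on_isQuotientEquivQuotientPrime R with
    | subsingleton N =>
      intro _
      refine Set.Finite.subset Set.finite_empty ?_
      intro q hq
      refine hq (van_zero I _ q (ModuleCat.of R N) ?_)
      change q ∉ Module.support R N
      rw [Module.support_eq_empty]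
      exact Set.notMem_empty q
    | quotient N p e =>
      intro hdim
      by_cases hI : I ≤ p.asIdeal
      · refine Set.Finite.subset Set.finite_empty ?_
        intro q hq
        refine hq (van_torsion I (ModuleCat.of R N) ?_ d q)
        intro a ha y
        change a • (y : N) = 0
        apply e.injective
        rw [map_smul, map_zero]
        obtain ⟨z, hz⟩ := Submodule.Quotient.mk_surjective _ (e y)
        rw [← hz, ← Submodule.Quotient.mk_smul, Submodule.Quotient.mk_eq_zero, smul_eq_mul]
        exact Ideal.mul_mem_right _ _ (hI ha)
      · obtain ⟨a, haI, hap⟩ := Set.not_subset.1 hI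
        have reg : IsSMulRegular N a := by
          refine (isSMulRegular_iff_right_eq_zero_of_smul).2 ?_
          intro y hy
          apply e.injective
          rw [map_zero]
          have h0 : a • e y = 0 := by rw [← map_smul, hy, map_zero]
          obtain ⟨z, hz⟩ := Submodule.Quotient.mk_surjective _ (e y)
          rw [← hz] at h0 ⊢
          rw [← Submodule.Quotient.mk_smul, Submodule.Quotient.mk_eq_zero, smul_eq_mul] at h0
          rw [Submodule.Quotient.mk_eq_zero]
          exact (p.2.mem_or_mem h0).resolve_left hap
        have h1 := (Module.supportDim_quotSMulTop_succ_le_of_notMem_minimalPrimes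
          (fun _ => reg.notMem_of_mem_minimalPrimes)).trans hdim
        have h2 : Module.supportDim R (QuotSMulTop a N) ≤ ((d + 1 : ℕ) : WithBot ℕ∞) := by
          rw [Nat.cast_add (d + 1) 1] at h1
          exact ENat.WithBot.add_le_add_natCast_right_iff.1 h1
        refine (ih (QuotSMulTop a N) h2).subset ?_
        intro q hq hv
        refine hq (van_succ I d q a haI (N := ModuleCat.of R N)
          (Q := ModuleCat.of R (QuotSMulTop a N)) (ModuleCat.ofHom (Submodule.mkQ _)) ?_ ?_ hv)
        · exact (ModuleCat.smulShortComplex (ModuleCat.of R N) a).zero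
        · exact IsSMulRegular.smulShortComplex_shortExact (M := ModuleCat.of R N) reg
    | exact N₁ N₂ N₃ f g hf hg hfg h₁ h₃ =>
      intro hdim
      refine ((h₁ ((Module.supportDim_le_of_injective f hf).trans hdim)).union
        (h₃ ((Module.supportDim_le_of_surjective g hg).trans hdim))).subset ?_
      intro q hq
      by_contra hcon
      rw [Set.mem_union, not_or] at hcon
      obtain ⟨c1, c2⟩ := hcon
      let S : ShortComplex (ModuleCat.{u} R) :=
        ShortComplex.mk (ModuleCat.ofHom f) (ModuleCat.ofHom g)
          (by ext x; exact hfg.apply_apply_eq_zero x)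
      have hS : S.ShortExact :=
        { exact := (ShortComplex.ShortExact.moduleCat_exact_iff_function_exact S).2 hfg
          mono_f := (ModuleCat.mono_iff_injective _).2 hf
          epi_g := (ModuleCat.epi_iff_surjective _).2 hg }
      exact hq (van_exact I (d + 1) q S hS (not_not.1 c1) (not_not.1 c2))

end Main

variable {R : Type u} [CommRing R] [IsNoetherianRing R] [IsLocalRing R]

theorem stmt_1 (I : Ideal R) (N : Type u) [AddCommGroup N] [Module R N] [Module.Finite R N] (n : ℕ)
    (hn : ringKrullDim (R ⧸ Module.annihilator R N) = (n : WithBot ℕ∞)) :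
    (Module.support R ((localCohomology I (n - 1)).obj (ModuleCat.of R N))).Finite := by
  rw [← Module.supportDim_eq_ringKrullDim_quotient_annihilator] at hn
  by_cases hn1 : n ≤ 1
  · refine (finite_support_of_dim_le_one N ?_).subset
      (lc_support_subset I (n - 1) (ModuleCat.of R N))
    rw [hn]
    exact_mod_cast hn1
  · obtain ⟨d, rfl⟩ : ∃ d, n = d + 2 := ⟨n - 2, by lia⟩
    refine (main_claim I (d + 1) N hn.le).subset ?_
    intro q hq hv
    exact notMem_support_of_van I (d + 1) (by lia) (ModuleCat.of R N) q hv hq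

end
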